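/- arXiv:2301.00753 — 6 statements merged into one kernel-verified Lean document; each statement's English description precedes it below -/
import Mathlib

section
/- Let f be a monic irreducible divisor of x^n−1 over F_p with deg(f)=k, and let N be the ideal of R = F_{p^2}[x]/⟨x^n−1⟩ generated by (x^n−1)/f. Then for every nonzero r ∈ N, the set {r, x·r, …, x^{k−1}·r} is a basis of the F_p[x]-submodule of R generated by r, viewed as an F_p-vector space. -/
open Polynomial

/-- `R = F_{p^2}[x]/⟨x^n - 1⟩`. -/
abbrev Rq (p n : ℕ) [Fact p.Prime] : Type :=
  AdjoinRoot ((X : Polynomial (GaloisField p 2)) ^ n - 1)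

/-- The natural ring homomorphism `F_p[x] → F_{p^2}[x]/⟨x^n - 1⟩`. -/
noncomputable def phi (p n : ℕ) [Fact p.Prime] : Polynomial (ZMod p) →+* Rq p n :=
  (AdjoinRoot.mk _).comp (mapRingHom (algebraMap (ZMod p) (GaloisField p 2)))

theorem phi_C_mul (p n : ℕ) [Fact p.Prime] (c : ZMod p) (x : Rq p n) :
    phi p n (C c) * x = c • x := by
  rw [Algebra.smul_def]
  exact congrArg (· * x)
    (RingHom.congr_fun (RingHom.ext_zmod ((phi p n).comp C) (algebraMap (ZMod p) (Rq p n))) c)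

/-- Multiplication of a fixed `r` by polynomials over `F_p`, as an `F_p`-linear map. -/
noncomputable def phiMul (p n : ℕ) [Fact p.Prime] (r : Rq p n) :
    Polynomial (ZMod p) →ₗ[ZMod p] Rq p n where
  toFun a := phi p n a * r
  map_add' a b := by rw [map_add, add_mul]
  map_smul' c a := by rw [smul_eq_C_mul, map_mul, mul_assoc, phi_C_mul, RingHom.id_apply]

theorem phi_X_pow_sub_one (p n : ℕ) [Fact p.Prime] : phi p n (X ^ n - 1) = 0 := by
  simp only [phi, RingHom.comp_apply, coe_mapRingHom, Polynomial.map_sub, Polynomial.map_pow,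
    map_X, Polynomial.map_one]
  exact AdjoinRoot.mk_self

theorem phi_mul_eq_zero_of_mem_span (p n : ℕ) [Fact p.Prime] {f : Polynomial (ZMod p)}
    (hf0 : f ≠ 0) (hdvd : f ∣ X ^ n - 1) {r : Rq p n}
    (hrN : r ∈ Ideal.span {phi p n ((X ^ n - 1) / f)}) : phi p n f * r = 0 := by
  obtain ⟨s, rfl⟩ := Ideal.mem_span_singleton'.1 hrN
  rw [mul_left_comm, ← map_mul, EuclideanDomain.mul_div_cancel' hf0 hdvd, phi_X_pow_sub_one,
    mul_zero]

theorem dvd_of_phi_mul_eq_zero (p n : ℕ) [Fact p.Prime] {f a : Polynomial (ZMod p)}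
    (hirr : Irreducible f) {r : Rq p n} (hr0 : r ≠ 0) (hf : phi p n f * r = 0)
    (ha : phi p n a * r = 0) : f ∣ a := by
  by_contra h
  obtain ⟨u, v, huv⟩ := (hirr.coprime_iff_not_dvd).2 h
  apply hr0
  have h1 := congrArg (fun q => phi p n q * r) huv
  simp only [map_add, map_mul, map_one, add_mul, one_mul, mul_assoc, hf, ha, mul_zero,
    add_zero] at h1
  exact h1.symm

/-- if `f` is a monic irreducible divisor of `x^n − 1` over `F_p` with
`deg f = k`, `N = ⟨(x^n−1)/f⟩ ⊆ R = F_{p^2}[x]/⟨x^n−1⟩`, and `0 ≠ r ∈ N`, then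
`{r, x·r, …, x^{k−1}·r}` is a basis, as an `F_p`-vector space, of the `F_p[x]`-submodule
of `R` generated by `r` (which, as a set, is `{a(x)·r : a ∈ F_p[x]}`). -/
theorem basis_of_irreducible_component
    (p n : ℕ) [Fact p.Prime] (hn : 0 < n) (hco : Nat.Coprime n p)
    (f : Polynomial (ZMod p)) (hmon : f.Monic) (hirr : Irreducible f)
    (hdvd : f ∣ X ^ n - 1) (k : ℕ) (hk : f.natDegree = k)
    (r : Rq p n) (hr0 : r ≠ 0)
    (hrN : r ∈ Ideal.span {phi p n ((X ^ n - 1) / f)}) :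
    LinearIndependent (ZMod p) (fun j : Fin k => phi p n (X ^ (j : ℕ)) * r) ∧
      (Submodule.span (ZMod p)
          (Set.range (fun j : Fin k => phi p n (X ^ (j : ℕ)) * r)) : Set (Rq p n)) =
        {w : Rq p n | ∃ a : Polynomial (ZMod p), w = phi p n a * r} := by
  subst hk
  have hf := phi_mul_eq_zero_of_mem_span p n hmon.ne_zero hdvd hrN
  constructor
  · rw [Fintype.linearIndependent_iff]
    intro g hg
    set q : Polynomial (ZMod p) := ∑ j : Fin f.natDegree, C (g j) * X ^ (j : ℕ) with hq
    have hq0 : q = 0 := by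
      refine eq_zero_of_dvd_of_degree_lt (dvd_of_phi_mul_eq_zero p n hirr hr0 hf ?_) ?_
      · rw [← hg, hq, map_sum, Finset.sum_mul]
        exact Finset.sum_congr rfl fun j _ => by rw [map_mul, mul_assoc, phi_C_mul]
      · rw [degree_eq_natDegree hmon.ne_zero]
        exact degree_sum_fin_lt g
    intro i
    have hi := congrArg (fun s => coeff s (i : ℕ)) hq0
    simpa [hq, coeff_C_mul, coeff_X_pow, Fin.val_inj] using hi
  · ext w
    simp only [SetLike.mem_coe, Set.mem_ofPred_eq]
    constructor
    · intro hw
      have hle : Submodule.span (ZMod p)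
          (Set.range (fun j : Fin f.natDegree => phi p n (X ^ (j : ℕ)) * r)) ≤
            LinearMap.range (phiMul p n r) := by
        rw [Submodule.span_le]
        rintro _ ⟨j, rfl⟩
        exact ⟨X ^ (j : ℕ), rfl⟩
      obtain ⟨a, rfl⟩ := hle hw
      exact ⟨a, rfl⟩
    · rintro ⟨a, rfl⟩
      have hmod : phi p n a * r = phi p n (a %ₘ f) * r := by
        conv_lhs => rw [← modByMonic_add_div a f]
        rw [map_add, add_mul, map_mul, mul_right_comm, hf, zero_mul, add_zero]
      rw [hmod, as_sum_range' (a %ₘ f) f.natDegree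
        (natDegree_modByMonic_lt a hmon hirr.ne_one), map_sum, Finset.sum_mul]
      refine Submodule.sum_mem _ fun j hj => ?_
      rw [← C_mul_X_pow_eq_monomial, map_mul, mul_assoc, phi_C_mul]
      exact Submodule.smul_mem _ _ (Submodule.subset_span ⟨⟨j, Finset.mem_range.1 hj⟩, rfl⟩)
end

section
/- Let f be a monic irreducible divisor of x^n−1 over F_p with deg(f)=k, and let N be the ideal of R = F_{p^2}[x]/⟨x^n−1⟩ generated by (x^n−1)/f. If C is a nonzero F_p[x]-submodule of R with C ⊊ N, then dim_{F_p}(C) = k and C equals the F_p[x]-submodule generated by r for every nonzero r ∈ C. -/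
open Polynomial

/-- The `F[X]`-submodule generated by `r`, as an `F`-subspace. -/
noncomputable def orbit {F R : Type*} [Field F] [CommRing R] [Algebra F R]
    (φ : F[X] →ₐ[F] R) (r : R) : Submodule F R :=
  LinearMap.range (LinearMap.mulRight F r ∘ₗ φ.toLinearMap)

section Orbit

variable {F R : Type*} [Field F] [CommRing R] [Algebra F R] {φ : F[X] →ₐ[F] R} {f : F[X]}

theorem mem_orbit {r w : R} : w ∈ orbit φ r ↔ ∃ a, φ a * r = w := by
  simp [orbit]

theorem self_mem_orbit (r : R) : r ∈ orbit φ r := mem_orbit.2 ⟨1, by simp⟩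

theorem exists_inverse_of_mul_ne_zero (hf : Irreducible f) {r : R} (hr : φ f * r = 0)
    {a : F[X]} (ha : φ a * r ≠ 0) : ∃ u, φ u * (φ a * r) = r := by
  have hfa : ¬ f ∣ a := by
    rintro ⟨c, rfl⟩
    exact ha (by rw [map_mul, mul_right_comm, hr, zero_mul])
  obtain ⟨u, v, huv⟩ := (hf.coprime_iff_not_dvd.2 hfa)
  refine ⟨v, ?_⟩
  have h := congrArg (fun z => φ z * r) huv
  simp only [map_add, map_mul, map_one, one_mul] at h
  linear_combination h - φ u * hr

theorem finrank_orbit (hf : Irreducible f) {r : R} (hr : φ f * r = 0) (hr0 : r ≠ 0) :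
    Module.finrank F (orbit φ r) = f.natDegree := by
  have hker : LinearMap.ker (LinearMap.mulRight F r ∘ₗ φ.toLinearMap) =
      (Ideal.span {f}).restrictScalars F := by
    ext a
    simp only [LinearMap.mem_ker, LinearMap.comp_apply, AlgHom.toLinearMap_apply,
      LinearMap.mulRight_apply, Submodule.restrictScalars_mem, Ideal.mem_span_singleton]
    constructor
    · intro ha
      by_contra hfa
      obtain ⟨u, v, huv⟩ := hf.coprime_iff_not_dvd.2 hfa
      have h := congrArg (fun z => φ z * r) huv
      simp only [map_add, map_mul, map_one, one_mul] at h
      exact hr0 (by linear_combination φ u * hr + φ v * ha - h)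
    · rintro ⟨c, rfl⟩
      rw [map_mul, mul_right_comm, hr, zero_mul]
  rw [orbit, ← (LinearMap.quotKerEquivRange _).finrank_eq, hker,
    (Submodule.Quotient.restrictScalarsEquiv F (Ideal.span {f})).finrank_eq]
  exact finrank_quotient_span_eq_natDegree

theorem finrank_orbit_le (hf : Irreducible f) {r : R} (hr : φ f * r = 0) :
    Module.finrank F (orbit φ r) ≤ f.natDegree := by
  by_cases hr0 : r = 0
  · have : orbit φ r = ⊥ := by
      subst hr0
      exact (Submodule.eq_bot_iff _).2 fun x hx => by simpa [eq_comm] using mem_orbit.1 hx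
    rw [this, finrank_bot]
    exact Nat.zero_le _
  · exact (finrank_orbit hf hr hr0).le

theorem orbit_le {C : Submodule F R} (hC : ∀ c ∈ C, φ X * c ∈ C) {r : R} (hr : r ∈ C) :
    orbit φ r ≤ C := by
  intro w hw
  obtain ⟨a, rfl⟩ := mem_orbit.1 hw
  induction a using Polynomial.induction_on with
  | C c =>
    rw [← algebraMap_eq, AlgHom.commutes, ← Algebra.smul_def]
    exact C.smul_mem c hr
  | add a b ha hb =>
    rw [map_add, add_mul]
    exact C.add_mem (ha (mem_orbit.2 ⟨a, rfl⟩)) (hb (mem_orbit.2 ⟨b, rfl⟩))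
  | monomial m c h =>
    rw [pow_succ, ← mul_assoc, map_mul, mul_comm (φ _), mul_assoc]
    exact hC _ (h (mem_orbit.2 ⟨_, rfl⟩))

theorem disjoint_orbit (hf : Irreducible f) {r s : R} (hs : φ f * s = 0)
    (hsr : s ∉ orbit φ r) : Disjoint (orbit φ r) (orbit φ s) := by
  rw [Submodule.disjoint_def]
  intro w hwr hws
  by_contra hw
  obtain ⟨a, rfl⟩ := mem_orbit.1 hws
  obtain ⟨b, hb⟩ := mem_orbit.1 hwr
  obtain ⟨u, hu⟩ := exists_inverse_of_mul_ne_zero hf hs hw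
  exact hsr (mem_orbit.2 ⟨u * b, by rw [map_mul, mul_assoc, hb, hu]⟩)

theorem eq_orbit_of_lt [FiniteDimensional F R] (hf : Irreducible f) {N C : Submodule F R}
    (hN : ∀ x ∈ N, φ f * x = 0) (hdim : Module.finrank F N ≤ 2 * f.natDegree)
    (hC : ∀ c ∈ C, φ X * c ∈ C) (hCN : C < N) {r : R} (hr : r ∈ C) (hr0 : r ≠ 0) :
    C = orbit φ r := by
  refine le_antisymm (fun s hs => ?_) (orbit_le hC hr)
  by_contra hsr
  have hs0 : s ≠ 0 := by
    rintro rfl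
    exact hsr (Submodule.zero_mem _)
  have hfr := hN r (hCN.le hr)
  have hfs := hN s (hCN.le hs)
  have hsum := Submodule.finrank_sup_add_finrank_inf_eq (orbit φ r) (orbit φ s)
  rw [(disjoint_orbit hf hfs hsr).eq_bot, finrank_bot, finrank_orbit hf hfr hr0,
    finrank_orbit hf hfs hs0] at hsum
  have hle := Submodule.finrank_mono (sup_le (orbit_le hC hr) (orbit_le hC hs))
  have hlt := Submodule.finrank_lt_finrank_of_lt hCN
  omega

end Orbit

/-- `phi` as an `F_p`-algebra homomorphism. -/
noncomputable def phiAlgHom (p n : ℕ) [Fact p.Prime] : (ZMod p)[X] →ₐ[ZMod p] Rq p n where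
  __ := phi p n
  commutes' c := by
    simp only [phi, RingHom.toMonoidHom_eq_coe, OneHom.toFun_eq_coe, MonoidHom.toOneHom_coe,
      MonoidHom.coe_coe, RingHom.comp_apply, coe_mapRingHom, algebraMap_eq, map_C,
      AdjoinRoot.mk_C]
    exact (IsScalarTower.algebraMap_apply (ZMod p) (GaloisField p 2) (Rq p n) c).symm

theorem phiAlgHom_apply (p n : ℕ) [Fact p.Prime] (a : (ZMod p)[X]) :
    phiAlgHom p n a = phi p n a := rfl

theorem finiteDimensional_Rq (p n : ℕ) [Fact p.Prime] (hn : 0 < n) :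
    FiniteDimensional (ZMod p) (Rq p n) := by
  have hmonic : ((X : (GaloisField p 2)[X]) ^ n - 1).Monic := monic_X_pow_sub_C 1 hn.ne'
  have : Module.Finite (GaloisField p 2) (Rq p n) := hmonic.finite_adjoinRoot
  exact Module.Finite.trans (GaloisField p 2) (Rq p n)

theorem finrank_span_singleton_le (p n : ℕ) [Fact p.Prime] (hn : 0 < n) {f : (ZMod p)[X]}
    (hf : Irreducible f) {h : Rq p n} (hh : phi p n f * h = 0) :
    Module.finrank (ZMod p) ((Ideal.span {h}).restrictScalars (ZMod p)) ≤ 2 * f.natDegree := by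
  have := finiteDimensional_Rq p n hn
  let b := Module.finBasisOfFinrankEq (ZMod p) (GaloisField p 2)
    (GaloisField.finrank p two_ne_zero)
  let g : Fin 2 → Rq p n := fun i => AdjoinRoot.of _ (b i) * h
  have hg (i : Fin 2) : phiAlgHom p n f * g i = 0 := by
    rw [phiAlgHom_apply, mul_left_comm, hh, mul_zero]
  have hle : (Ideal.span {h}).restrictScalars (ZMod p) ≤
      orbit (phiAlgHom p n) (g 0) ⊔ orbit (phiAlgHom p n) (g 1) := by
    intro w hw
    obtain ⟨z, rfl⟩ := Ideal.mem_span_singleton'.1 hw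
    clear hw
    obtain ⟨z, rfl⟩ := AdjoinRoot.mk_surjective z
    induction z using Polynomial.induction_on' with
    | add u v hu hv =>
      rw [map_add, add_mul]
      exact Submodule.add_mem _ hu hv
    | monomial m c =>
      have hmon (i : Fin 2) :
          phiAlgHom p n (monomial m (b.repr c i)) * g i =
            AdjoinRoot.mk _ (monomial m (b.repr c i • b i)) * h := by
        rw [phiAlgHom_apply, ← mul_assoc, phi, RingHom.comp_apply, coe_mapRingHom,
          map_monomial, ← AdjoinRoot.mk_C, ← map_mul, monomial_mul_C, Algebra.smul_def]
      have hc := b.sum_repr c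
      rw [Fin.sum_univ_two] at hc
      rw [← hc, map_add, map_add, add_mul, ← hmon, ← hmon]
      exact Submodule.add_mem_sup (mem_orbit.2 ⟨_, rfl⟩) (mem_orbit.2 ⟨_, rfl⟩)
  have h0 := finrank_orbit_le hf (hg 0)
  have h1 := finrank_orbit_le hf (hg 1)
  have hsup := Submodule.finrank_add_le_finrank_add_finrank
    (orbit (phiAlgHom p n) (g 0)) (orbit (phiAlgHom p n) (g 1))
  have := Submodule.finrank_mono hle
  omega

/-- let `f` be a monic irreducible divisor of `x^n − 1` over `F_p` with
`deg f = k` and `N = ⟨(x^n−1)/f⟩ ⊆ R = F_{p^2}[x]/⟨x^n−1⟩`.  If `C` is a nonzero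
`F_p[x]`-submodule of `R` (an `F_p`-subspace closed under multiplication by `x`) with
`C ⊊ N`, then `dim_{F_p} C = k` and `C` is the `F_p[x]`-submodule generated by `r`
(i.e. `C = {a(x)·r : a(x) ∈ F_p[x]}`) for every nonzero `r ∈ C`. -/
theorem irreducible_component_submodules
    (p n : ℕ) [Fact p.Prime] (hn : 0 < n) (hco : Nat.Coprime n p)
    (f : Polynomial (ZMod p)) (hmon : f.Monic) (hirr : Irreducible f)
    (hdvd : f ∣ X ^ n - 1) (k : ℕ) (hk : f.natDegree = k)
    (C : Submodule (ZMod p) (Rq p n))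
    (hshift : ∀ c ∈ C, phi p n X * c ∈ C)
    (hC0 : C ≠ ⊥)
    (hCN : (C : Set (Rq p n)) ⊂
      (Ideal.span {phi p n ((X ^ n - 1) / f)} : Ideal (Rq p n))) :
    Module.finrank (ZMod p) C = k ∧
      ∀ r ∈ C, r ≠ 0 →
        (C : Set (Rq p n)) = {w : Rq p n | ∃ a : Polynomial (ZMod p), w = phi p n a * r} := by
  have := finiteDimensional_Rq p n hn
  have hh : phi p n f * phi p n ((X ^ n - 1) / f) = 0 := by
    rw [← map_mul, EuclideanDomain.mul_div_cancel' hirr.ne_zero hdvd, phi_X_pow_sub_one]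
  have hN : ∀ x ∈ (Ideal.span {phi p n ((X ^ n - 1) / f)}).restrictScalars (ZMod p),
      phiAlgHom p n f * x = 0 := by
    intro x hx
    obtain ⟨z, rfl⟩ := Ideal.mem_span_singleton'.1 hx
    rw [phiAlgHom_apply, mul_left_comm, hh, mul_zero]
  have hlt : C < (Ideal.span {phi p n ((X ^ n - 1) / f)}).restrictScalars (ZMod p) := hCN
  have horbit {r : Rq p n} (hr : r ∈ C) (hr0 : r ≠ 0) : C = orbit (phiAlgHom p n) r :=
    eq_orbit_of_lt hirr hN (finrank_span_singleton_le p n hn hirr hh) hshift hlt hr hr0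
  constructor
  · obtain ⟨r, hr, hr0⟩ := C.ne_bot_iff.1 hC0
    rw [horbit hr hr0, finrank_orbit hirr (hN r (hlt.le hr)) hr0, hk]
  · intro r hr hr0
    ext w
    rw [SetLike.mem_coe, horbit hr hr0, mem_orbit]
    exact exists_congr fun a => eq_comm
end

section
/- Every additive cyclic code C of length n over F_{p^2} (i.e., every F_p[x]-submodule of R = F_{p^2}[x]/⟨x^n−1⟩) is generated as an F_p[x]-module by at most two elements, which may be chosen of the form g(x) + ω·k(x) and ω·h(x) with g, k, h ∈ F_p[x]. -/
open Polynomial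

/-- Let `A` be a principal ideal ring mapping to `R`, and suppose `R` is spanned over `A` by `1`
and `w`. Every additive subgroup of `R` stable under `A` is generated over `A` by two elements
`g + w * k` and `w * h`. -/
theorem exists_triangular_generators {A R : Type*} [CommRing A] [IsPrincipalIdealRing A]
    [CommRing R] (f : A →+* R) (w : R) (hspan : ∀ r : R, ∃ u v : A, r = f u + w * f v)
    (M : AddSubgroup R) (hM : ∀ (a : A), ∀ c ∈ M, f a * c ∈ M) :
    ∃ g k h : A, (M : Set R) =
      {r : R | ∃ a b : A, r = f a * (f g + w * f k) + f b * (w * f h)} := by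
  let J : Ideal A :=
    { carrier := {u | ∃ v, f u + w * f v ∈ M}
      zero_mem' := ⟨0, by simp⟩
      add_mem' := by
        rintro u u' ⟨v, hv⟩ ⟨v', hv'⟩
        refine ⟨v + v', ?_⟩
        convert M.add_mem hv hv' using 1
        simp only [map_add]
        ring
      smul_mem' := by
        rintro a u ⟨v, hv⟩
        refine ⟨a * v, ?_⟩
        convert hM a _ hv using 1
        simp only [smul_eq_mul, map_mul]
        ring }
  let K : Ideal A :=
    { carrier := {v | w * f v ∈ M}
      zero_mem' := by simp
      add_mem' := by
        intro v v' hv hv'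
        simpa only [Set.mem_ofPred_eq, map_add, mul_add] using M.add_mem hv hv'
      smul_mem' := by
        intro a v hv
        have := hM a _ hv
        simpa only [Set.mem_ofPred_eq, smul_eq_mul, map_mul, mul_left_comm] using this }
  obtain ⟨g, hg⟩ := IsPrincipalIdealRing.principal J
  obtain ⟨h, hh⟩ := IsPrincipalIdealRing.principal K
  obtain ⟨k, hk⟩ : g ∈ J := hg ▸ Ideal.mem_span_singleton_self g
  have hhK : w * f h ∈ M := by
    have : h ∈ K := hh ▸ Ideal.mem_span_singleton_self h
    exact this
  refine ⟨g, k, h, Set.ext fun r => ⟨fun hr => ?_, ?_⟩⟩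
  · obtain ⟨u, v, rfl⟩ := hspan r
    have hu : u ∈ J := ⟨v, hr⟩
    rw [hg] at hu
    obtain ⟨a, rfl⟩ := Ideal.mem_span_singleton'.mp hu
    have hv : v - a * k ∈ K := by
      change w * f (v - a * k) ∈ M
      convert M.sub_mem hr (hM a _ hk) using 1
      simp only [map_sub, map_mul]
      ring
    rw [hh] at hv
    obtain ⟨b, hb⟩ := Ideal.mem_span_singleton'.mp hv
    refine ⟨a, b, ?_⟩
    rw [eq_add_of_sub_eq hb.symm]
    simp only [map_add, map_mul]
    ring
  · rintro ⟨a, b, rfl⟩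
    exact M.add_mem (hM a _ hk) (hM b _ hhK)

/-- A root of an irreducible quadratic spans a quadratic extension together with `1`. -/
theorem exists_eq_add_mul_of_irreducible_quadratic {F L : Type*} [Field F] [Field L] [Algebra F L]
    (hL : Module.finrank F L = 2) {ω : L} {q : F[X]} (hq : Irreducible q)
    (hdeg : q.natDegree = 2) (hroot : aeval ω q = 0) (z : L) :
    ∃ α β : F, z = algebraMap F L α + ω * algebraMap F L β := by
  have hω : ∀ r : F, algebraMap F L r ≠ ω := by
    rintro r rfl
    have hr : q.IsRoot r := by
      rw [aeval_algebraMap_apply] at hroot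
      simpa using hroot
    have : q.natDegree = 1 := natDegree_eq_of_degree_eq_some
      (degree_eq_one_of_irreducible_of_root hq hr)
    omega
  have hli : LinearIndependent F ![(1 : L), ω] := by
    rw [LinearIndependent.pair_iff' one_ne_zero]
    intro r
    rw [← Algebra.algebraMap_eq_smul_one]
    exact hω r
  have hz : z ∈ Submodule.span F (Set.range ![(1 : L), ω]) := by
    rw [hli.span_eq_top_of_card_eq_finrank (by simp [hL])]
    trivial
  rw [Matrix.range_cons_cons_empty, Submodule.mem_span_pair] at hz
  obtain ⟨α, β, rfl⟩ := hz
  exact ⟨α, β, by rw [Algebra.smul_def, Algebra.smul_def, mul_one, mul_comm ω]⟩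

/-- every additive cyclic code `C` of length `n` over `F_{p^2}` (an
`F_p`-subspace of `R = F_{p^2}[x]/⟨x^n−1⟩` closed under multiplication by `x`, i.e. an
`F_p[x]`-submodule of `R`) is generated as an `F_p[x]`-module by two elements of the form
`g(x) + ω·k(x)` and `ω·h(x)` with `g, k, h ∈ F_p[x]`. -/
theorem two_generator_representation
    (p n : ℕ) [Fact p.Prime] (hn : 0 < n) (hco : Nat.Coprime n p)
    (ω : GaloisField p 2)
    (hω : ∃ q : Polynomial (ZMod p), Irreducible q ∧ q.natDegree = 2 ∧
      Polynomial.aeval ω q = 0)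
    (C : Submodule (ZMod p) (Rq p n))
    (hshift : ∀ c ∈ C, phi p n X * c ∈ C) :
    ∃ g k h : Polynomial (ZMod p),
      (C : Set (Rq p n)) =
        {w : Rq p n | ∃ a b : Polynomial (ZMod p),
          w = phi p n a * (phi p n g + algebraMap (GaloisField p 2) (Rq p n) ω * phi p n k) +
              phi p n b * (algebraMap (GaloisField p 2) (Rq p n) ω * phi p n h)} := by
  obtain ⟨q, hq, hdeg, hroot⟩ := hω
  refine exists_triangular_generators (phi p n) _ ?_ C.toAddSubgroup ?_
  · intro r
    obtain ⟨P, rfl⟩ := AdjoinRoot.mk_surjective r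
    induction P using Polynomial.induction_on' with
    | add P Q hP hQ =>
      obtain ⟨u, v, hP⟩ := hP
      obtain ⟨u', v', hQ⟩ := hQ
      refine ⟨u + u', v + v', ?_⟩
      rw [map_add, hP, hQ, map_add, map_add]
      ring
    | monomial m z =>
      obtain ⟨α, β, rfl⟩ := exists_eq_add_mul_of_irreducible_quadratic
        (GaloisField.finrank p two_ne_zero) hq hdeg hroot z
      refine ⟨monomial m α, monomial m β, ?_⟩
      rw [AdjoinRoot.algebraMap_eq, ← AdjoinRoot.mk_C]
      simp only [phi, RingHom.comp_apply, coe_mapRingHom, map_monomial, ← map_mul, ← map_add,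
        C_mul_monomial]
  · intro a c hc
    change c ∈ C at hc
    change phi p n a * c ∈ C
    induction a using Polynomial.induction_on generalizing c with
    | C r =>
      have : phi p n (Polynomial.C r) = algebraMap (ZMod p) (Rq p n) r := by
        simp [phi, AdjoinRoot.algebraMap_eq']
      rw [this, ← Algebra.smul_def]
      exact C.smul_mem r hc
    | add P Q hP hQ =>
      rw [map_add, add_mul]
      exact C.add_mem (hP c hc) (hQ c hc)
    | monomial m r ih =>
      rw [pow_succ, ← mul_assoc, map_mul, mul_assoc]
      exact ih _ (hshift c hc)
end

section
/- Let C be an additive cyclic code of length n over F_{p^2}. Then C is irreducible if and only if C = ⟨r⟩_{F_p[x]} for some nonzero r ∈ N_i and some 1 ≤ i ≤ s. Moreover, the number of distinct irreducible additive cyclic codes of length n over F_{p^2} is ∑_{i=1}^s (p^{deg f_i} + 1). (The paper states the count with base 2, which is the value in the binary case p=2.) -/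
open Polynomial

/-- An additive cyclic code: an `F_p`-subspace of `R` closed under multiplication by `x`,
i.e. an `F_p[x]`-submodule of `R`. -/
def IsAdditiveCyclic (p n : ℕ) [Fact p.Prime] (C : Submodule (ZMod p) (Rq p n)) : Prop :=
  ∀ c ∈ C, phi p n X * c ∈ C

/-- An irreducible additive cyclic code: a nonzero additive cyclic code whose only additive
cyclic subcodes are `0` and itself. -/
def IsIrreducibleACC (p n : ℕ) [Fact p.Prime] (C : Submodule (ZMod p) (Rq p n)) : Prop :=
  IsAdditiveCyclic p n C ∧ C ≠ ⊥ ∧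
    ∀ D : Submodule (ZMod p) (Rq p n), IsAdditiveCyclic p n D → D ≤ C → D = ⊥ ∨ D = C

/-- The `F_p[x]`-submodule of `R` generated by `r`, as a set. -/
def genSet (p n : ℕ) [Fact p.Prime] (r : Rq p n) : Set (Rq p n) :=
  {w : Rq p n | ∃ a : Polynomial (ZMod p), w = phi p n a * r}

/-- An element killed by an irreducible `f` generates an atom. -/
theorem isAtom_span_singleton_of_irreducible_smul_eq_zero {A M : Type*} [CommRing A] [IsDomain A]
    [IsPrincipalIdealRing A] [AddCommGroup M] [Module A M] {f : A} (hf : Irreducible f) {r : M}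
    (hr : r ≠ 0) (h : f • r = 0) : IsAtom (Submodule.span A {r}) := by
  refine ⟨by simpa using hr, fun D hD => ?_⟩
  by_contra hne
  obtain ⟨d, hdD, hd0⟩ := (Submodule.ne_bot_iff D).1 hne
  obtain ⟨b, rfl⟩ := Submodule.mem_span_singleton.1 (hD.le hdD)
  have hndvd : ¬ f ∣ b := by
    rintro ⟨c, rfl⟩
    exact hd0 (by rw [mul_comm, mul_smul, h, smul_zero])
  obtain ⟨u, v, huv⟩ := (hf.coprime_iff_not_dvd).2 hndvd
  refine hD.not_ge ((Submodule.span_singleton_le_iff_mem _ _).2 ?_)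
  have : r = v • b • r := by
    calc r = (u * f + v * b) • r := by rw [huv, one_smul]
      _ = v • b • r := by rw [add_smul, mul_smul, h, smul_zero, zero_add, mul_smul]
  rw [this]
  exact D.smul_mem _ hdD

/-- If a product of elements kills a nonzero vector, one factor kills a nonzero multiple of it. -/
theorem exists_smul_eq_zero_of_prod_smul_eq_zero {A M ι : Type*} [CommRing A]
    [AddCommGroup M] [Module A M] (s : Finset ι) (f : ι → A) {r : M} (hr : r ≠ 0)
    (h : (∏ i ∈ s, f i) • r = 0) :
    ∃ i ∈ s, ∃ a : A, a • r ≠ 0 ∧ f i • a • r = 0 := by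
  classical
  induction s using Finset.induction_on with
  | empty => simp [hr] at h
  | insert j s hj ih =>
    by_cases h0 : (∏ i ∈ s, f i) • r = 0
    · obtain ⟨i, hi, H⟩ := ih h0
      exact ⟨i, Finset.mem_insert_of_mem hi, H⟩
    · refine ⟨j, Finset.mem_insert_self _ _, _, h0, ?_⟩
      rwa [Finset.prod_insert hj, mul_smul] at h

theorem isAtom_iff_exists_span_singleton {A M ι : Type*} [CommRing A] [IsDomain A]
    [IsPrincipalIdealRing A] [AddCommGroup M] [Module A M] [Fintype ι] {f : ι → A}
    (hf : ∀ i, Irreducible (f i)) (hM : ∀ m : M, (∏ i, f i) • m = 0) (C : Submodule A M) :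
    IsAtom C ↔ ∃ i, ∃ r : M, r ≠ 0 ∧ f i • r = 0 ∧ C = Submodule.span A {r} := by
  constructor
  · intro hC
    obtain ⟨m, hmC, hm0⟩ := (Submodule.ne_bot_iff C).1 hC.1
    obtain ⟨i, -, a, ha0, ha⟩ := exists_smul_eq_zero_of_prod_smul_eq_zero _ f hm0 (hM m)
    refine ⟨i, a • m, ha0, ha, ?_⟩
    have hle : Submodule.span A {a • m} ≤ C :=
      (Submodule.span_singleton_le_iff_mem _ _).2 (C.smul_mem _ hmC)
    exact ((hC.le_iff.1 hle).resolve_left (by simpa using ha0)).symm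
  · rintro ⟨i, r, hr, h, rfl⟩
    exact isAtom_span_singleton_of_irreducible_smul_eq_zero (hf i) hr h

theorem natCard_span_singleton_of_irreducible {A M : Type*} [CommRing A] [IsDomain A]
    [IsPrincipalIdealRing A] [AddCommGroup M] [Module A M] {f : A} (hf : Irreducible f) {r : M}
    (hr : r ≠ 0) (h : f • r = 0) :
    Nat.card (Submodule.span A {r}) = Nat.card (A ⧸ Ideal.span {f}) := by
  have hker : LinearMap.ker (LinearMap.toSpanSingleton A M r) = Ideal.span {f} := by
    refine ((PrincipalIdealRing.isMaximal_of_irreducible hf).eq_of_le ?_ ?_).symm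
    · rw [Ne, Ideal.eq_top_iff_one]
      simpa using hr
    · rw [Ideal.span_singleton_le_iff_mem]
      simpa using h
  rw [← LinearMap.range_toSpanSingleton, ← hker]
  exact (Nat.card_congr (LinearMap.quotKerEquivRange _).toEquiv).symm

/-- The number of lines in a torsion module of size `q ^ 2`, `q` the size of the residue field. -/
theorem ncard_span_singleton_torsion {A M : Type*} [CommRing A] [IsDomain A]
    [IsPrincipalIdealRing A] [AddCommGroup M] [Module A M] [Finite M] {f : A}
    (hf : Irreducible f) {q : ℕ} (hq : 1 < q) (hA : Nat.card (A ⧸ Ideal.span {f}) = q)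
    (hT : {r : M | f • r = 0}.ncard = q ^ 2) :
    {C : Submodule A M | ∃ r : M, r ≠ 0 ∧ f • r = 0 ∧ C = Submodule.span A {r}}.ncard
      = q + 1 := by
  classical
  have := Fintype.ofFinite M
  set T : Finset M := Finset.univ.filter fun r : M => r ≠ 0 ∧ f • r = 0 with hTdef
  have hTcard : T.card + 1 = q ^ 2 := by
    have hE : T = ({r : M | f • r = 0}.toFinset).erase 0 := by
      ext r
      simp [hTdef]
    rw [← hT, Set.ncard_eq_toFinset_card', hE, Finset.card_erase_add_one (by simp)]
  have himg : {C : Submodule A M | ∃ r : M, r ≠ 0 ∧ f • r = 0 ∧ C = Submodule.span A {r}}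
      = ((T.image fun r => Submodule.span A {r} : Finset (Submodule A M)) :
        Set (Submodule A M)) := by
    ext C
    simp [hTdef, and_assoc, eq_comm]
  have hfib : ∀ C ∈ T.image (fun r => Submodule.span A {r}),
      (T.filter fun r => Submodule.span A {r} = C).card = q - 1 := by
    intro C hC
    obtain ⟨r, hr, rfl⟩ := Finset.mem_image.1 hC
    obtain ⟨hr0, hr⟩ : r ≠ 0 ∧ f • r = 0 := by simpa [hTdef] using hr
    have hcard : ((Submodule.span A {r} : Submodule A M) : Set M).ncard = q := by
      rw [← hA, ← natCard_span_singleton_of_irreducible hf hr0 hr]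
      rfl
    rw [← hcard, Set.ncard_eq_toFinset_card',
      ← Finset.card_erase_of_mem (a := (0 : M)) (by simp)]
    congr 1
    ext w
    simp only [hTdef, Finset.mem_filter, Finset.mem_univ, true_and, Finset.mem_erase,
      Set.mem_toFinset, SetLike.mem_coe]
    constructor
    · rintro ⟨⟨hw, -⟩, h⟩
      exact ⟨hw, h ▸ Submodule.mem_span_singleton_self w⟩
    · rintro ⟨hw, h⟩
      refine ⟨⟨hw, ?_⟩, ?_⟩
      · obtain ⟨a, rfl⟩ := Submodule.mem_span_singleton.1 h
        rw [smul_comm, hr, smul_zero]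
      · exact ((isAtom_span_singleton_of_irreducible_smul_eq_zero hf hr0 hr).le_iff.1
          ((Submodule.span_singleton_le_iff_mem _ _).2 h)).resolve_left (by simpa using hw)
  have hsum := Finset.card_eq_sum_card_image (fun r => Submodule.span A {r}) T
  rw [Finset.sum_congr rfl hfib, Finset.sum_const, smul_eq_mul] at hsum
  rw [himg, Set.ncard_coe_finset]
  obtain ⟨k, rfl⟩ : ∃ k, q = k + 2 := ⟨q - 2, by omega⟩
  have h1 : k + 2 - 1 = k + 1 := rfl
  rw [h1] at hsum
  refine Nat.eq_of_mul_eq_mul_right (Nat.succ_pos k) ?_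
  rw [Nat.succ_eq_add_one, ← hsum]
  nlinarith

theorem AdjoinRoot.natCard_eq_pow_natDegree {K : Type*} [Field K] [Finite K] {g : K[X]}
    (hg : g.Monic) : Nat.card (AdjoinRoot g) = Nat.card K ^ g.natDegree := by
  have := hg.finite_adjoinRoot
  rw [Module.natCard_eq_pow_finrank (K := K)]
  exact congrArg _ (finrank_quotient_span_eq_natDegree (f := g))

namespace AdditiveCyclic

variable (p n : ℕ) [Fact p.Prime]

/-- `R` as an `F_p[x]`-module. -/
noncomputable local instance : Module (ZMod p)[X] (Rq p n) := Module.compHom _ (phi p n)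

theorem smul_eq (a : (ZMod p)[X]) (r : Rq p n) : a • r = phi p n a * r := rfl

theorem phi_C_mul (c : ZMod p) (r : Rq p n) : phi p n (C c) * r = c • r := by
  rw [Algebra.smul_def]
  congr 1
  exact RingHom.congr_fun (RingHom.ext_zmod ((phi p n).comp C) (algebraMap _ _)) c

local instance : IsScalarTower (ZMod p) (ZMod p)[X] (Rq p n) where
  smul_assoc c a r := by
    rw [smul_eq, smul_eq, Polynomial.smul_eq_C_mul, map_mul, mul_assoc, phi_C_mul]

theorem isAdditiveCyclic_iff (C : Submodule (ZMod p) (Rq p n)) :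
    IsAdditiveCyclic p n C ↔
      ∃ D : Submodule (ZMod p)[X] (Rq p n), D.restrictScalars (ZMod p) = C := by
  constructor
  · intro h
    refine ⟨{ C with smul_mem' := ?_ }, by ext; rfl⟩
    intro a
    induction a using Polynomial.induction_on' with
    | add a b ha hb =>
      intro r hr
      rw [add_smul]
      exact C.add_mem (ha hr) (hb hr)
    | monomial k c =>
      intro r hr
      rw [← C_mul_X_pow_eq_monomial, mul_smul, smul_eq, phi_C_mul]
      refine C.smul_mem c ?_
      induction k with
      | zero => simpa using hr
      | succ k ih =>
        rw [pow_succ', mul_smul, smul_eq]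
        exact h _ ih
  · rintro ⟨D, rfl⟩ c hc
    exact D.smul_mem X hc

theorem isIrreducibleACC_iff (C : Submodule (ZMod p) (Rq p n)) :
    IsIrreducibleACC p n C ↔
      ∃ D : Submodule (ZMod p)[X] (Rq p n), IsAtom D ∧ D.restrictScalars (ZMod p) = C := by
  constructor
  · rintro ⟨hC, h0, h⟩
    obtain ⟨D, rfl⟩ := (isAdditiveCyclic_iff p n C).1 hC
    refine ⟨D, ⟨fun hD => h0 (by simp [hD]), fun E hE => ?_⟩, rfl⟩
    rcases h (E.restrictScalars (ZMod p)) ((isAdditiveCyclic_iff p n _).2 ⟨E, rfl⟩) hE.le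
      with h1 | h1
    · simpa using h1
    · exact absurd (Submodule.restrictScalars_injective _ _ _ h1) hE.ne
  · rintro ⟨D, hD, rfl⟩
    refine ⟨(isAdditiveCyclic_iff p n _).2 ⟨D, rfl⟩, by simpa using hD.1, fun E hE hle => ?_⟩
    obtain ⟨E, rfl⟩ := (isAdditiveCyclic_iff p n E).1 hE
    rcases hD.le_iff.1 (show E ≤ D from hle) with rfl | rfl
    · left; simp
    · right; rfl

theorem genSet_eq (r : Rq p n) :
    genSet p n r = (Submodule.span (ZMod p)[X] {r} : Set (Rq p n)) := by
  ext w
  simp [genSet, Submodule.mem_span_singleton, smul_eq, eq_comm]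

theorem phi_X_pow_sub_one : phi p n (X ^ n - 1) = 0 := by
  simp only [phi, RingHom.comp_apply, coe_mapRingHom, Polynomial.map_sub, Polynomial.map_pow,
    Polynomial.map_X, Polynomial.map_one, AdjoinRoot.mk_self]

variable {p n}

theorem smul_eq_zero_iff {f g : (ZMod p)[X]} (hf : f ≠ 0) (hfg : f * g = X ^ n - 1)
    (r : Rq p n) : f • r = 0 ↔ r ∈ Ideal.span {phi p n g} := by
  rw [Ideal.mem_span_singleton, smul_eq]
  constructor
  · intro h
    obtain ⟨u, rfl⟩ := AdjoinRoot.mk_surjective r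
    have hd : (X : (GaloisField p 2)[X]) ^ n - 1 ∣
        f.map (algebraMap (ZMod p) (GaloisField p 2)) * u := by
      rw [← AdjoinRoot.mk_eq_zero, map_mul]
      exact h
    have hm : (X : (GaloisField p 2)[X]) ^ n - 1 =
        f.map (algebraMap (ZMod p) (GaloisField p 2)) * g.map (algebraMap _ _) := by
      rw [← Polynomial.map_mul, hfg]
      simp
    rw [hm, mul_dvd_mul_iff_left (by simpa using hf)] at hd
    exact map_dvd (AdjoinRoot.mk _) hd
  · rintro ⟨u, rfl⟩
    rw [← mul_assoc, ← map_mul, hfg, phi_X_pow_sub_one, zero_mul]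

theorem ncard_torsion {f g : (ZMod p)[X]} (hf : f.Monic) (hg : g ≠ 0)
    (hfg : f * g = X ^ n - 1) :
    {r : Rq p n | f • r = 0}.ncard = (p ^ f.natDegree) ^ 2 := by
  set F := f.map (algebraMap (ZMod p) (GaloisField p 2)) with hF
  set G := g.map (algebraMap (ZMod p) (GaloisField p 2)) with hG
  have hm : (X : (GaloisField p 2)[X]) ^ n - 1 = G * F := by
    rw [← Polynomial.map_mul, mul_comm, hfg]
    simp
  have hG0 : G ≠ 0 := by simpa [hG] using hg
  let _ : Module (GaloisField p 2)[X] (Rq p n) :=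
    Module.compHom _ (AdjoinRoot.mk ((X : (GaloisField p 2)[X]) ^ n - 1))
  let ψ : (GaloisField p 2)[X] →ₗ[(GaloisField p 2)[X]] Rq p n :=
    LinearMap.toSpanSingleton _ _ (phi p n g)
  have hψ : ∀ h, ψ h = AdjoinRoot.mk _ (h * G) := fun h => by
    rw [map_mul]; rfl
  have hker : LinearMap.ker ψ = Ideal.span {F} := by
    ext h
    rw [LinearMap.mem_ker, hψ, AdjoinRoot.mk_eq_zero, hm, mul_comm h,
      mul_dvd_mul_iff_left hG0, Ideal.mem_span_singleton]
  have hrange : {r : Rq p n | f • r = 0} = LinearMap.range ψ := by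
    ext r
    rw [Set.mem_ofPred_eq, smul_eq_zero_iff hf.ne_zero hfg, Ideal.mem_span_singleton]
    constructor
    · rintro ⟨u, rfl⟩
      obtain ⟨u, rfl⟩ := AdjoinRoot.mk_surjective u
      exact ⟨u, by rw [hψ, map_mul, mul_comm]; rfl⟩
    · rintro ⟨u, rfl⟩
      exact ⟨AdjoinRoot.mk _ u, by rw [hψ, map_mul, mul_comm]; rfl⟩
  have h1 : Nat.card (LinearMap.range ψ) = Nat.card (AdjoinRoot F) := by
    refine (Nat.card_congr (LinearMap.quotKerEquivRange ψ).toEquiv).symm.trans ?_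
    rw [hker]
    rfl
  rw [hrange]
  refine h1.trans ?_
  rw [AdjoinRoot.natCard_eq_pow_natDegree (hf.map _), GaloisField.card p 2 two_ne_zero,
    Polynomial.natDegree_map, ← pow_mul, ← pow_mul, mul_comm]

theorem finite_Rq (hn : 0 < n) : Finite (Rq p n) := by
  have hmon : ((X : (GaloisField p 2)[X]) ^ n - 1).Monic := by
    simpa using monic_X_pow_sub_C (1 : GaloisField p 2) hn.ne'
  have := hmon.finite_adjoinRoot
  exact Module.finite_of_finite (GaloisField p 2)

theorem isIrreducibleACC_iff_exists_genSet {s : ℕ} {f : Fin s → (ZMod p)[X]}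
    (hirr : ∀ i, Irreducible (f i)) (hprod : ∏ i, f i = X ^ n - 1)
    (C : Submodule (ZMod p) (Rq p n)) :
    IsIrreducibleACC p n C ↔ ∃ (i : Fin s) (r : Rq p n), r ≠ 0 ∧
      r ∈ Ideal.span {phi p n ((X ^ n - 1) / f i)} ∧ (C : Set (Rq p n)) = genSet p n r := by
  have hM : ∀ m : Rq p n, (∏ i, f i) • m = 0 := fun m => by
    rw [hprod, smul_eq, phi_X_pow_sub_one, zero_mul]
  have hdvd : ∀ i, f i * ((X ^ n - 1) / f i) = X ^ n - 1 := fun i =>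
    EuclideanDomain.mul_div_cancel' (hirr i).ne_zero
      (hprod ▸ Finset.dvd_prod_of_mem f (Finset.mem_univ i))
  simp_rw [isIrreducibleACC_iff, isAtom_iff_exists_span_singleton hirr hM, genSet_eq,
    ← smul_eq_zero_iff (hirr _).ne_zero (hdvd _)]
  constructor
  · rintro ⟨D, ⟨i, r, hr, h, rfl⟩, rfl⟩
    exact ⟨i, r, hr, h, rfl⟩
  · rintro ⟨i, r, hr, h, hC⟩
    exact ⟨_, ⟨i, r, hr, h, rfl⟩, SetLike.coe_injective hC.symm⟩

theorem ncard_isIrreducibleACC (hn : 0 < n) {s : ℕ} {f : Fin s → (ZMod p)[X]}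
    (hmon : ∀ i, (f i).Monic) (hirr : ∀ i, Irreducible (f i)) (hdist : Function.Injective f)
    (hprod : ∏ i, f i = X ^ n - 1) :
    {C : Submodule (ZMod p) (Rq p n) | IsIrreducibleACC p n C}.ncard =
      ∑ i, (p ^ (f i).natDegree + 1) := by
  have hfin := finite_Rq (p := p) hn
  have hX : (X ^ n - 1 : (ZMod p)[X]) ≠ 0 := by
    simpa using X_pow_sub_C_ne_zero hn (1 : ZMod p)
  have hM : ∀ m : Rq p n, (∏ i, f i) • m = 0 := fun m => by
    rw [hprod, smul_eq, phi_X_pow_sub_one, zero_mul]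
  have hset : {C : Submodule (ZMod p) (Rq p n) | IsIrreducibleACC p n C} =
      Submodule.restrictScalars (ZMod p) '' ⋃ i, {D : Submodule (ZMod p)[X] (Rq p n) |
        ∃ r : Rq p n, r ≠ 0 ∧ f i • r = 0 ∧ D = Submodule.span _ {r}} := by
    ext C
    simp only [Set.mem_ofPred_eq, isIrreducibleACC_iff, Set.mem_image, Set.mem_iUnion,
      isAtom_iff_exists_span_singleton hirr hM]
  have hdisj : Pairwise (Function.onFun Disjoint fun i =>
      {D : Submodule (ZMod p)[X] (Rq p n) |
        ∃ r : Rq p n, r ≠ 0 ∧ f i • r = 0 ∧ D = Submodule.span _ {r}}) := by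
    intro i j hij
    refine Set.disjoint_left.2 ?_
    rintro _ ⟨r, hr, h, rfl⟩ ⟨t, -, ht, heq⟩
    have hrt : r ∈ Submodule.span (ZMod p)[X] {t} := heq ▸ Submodule.mem_span_singleton_self r
    obtain ⟨a, rfl⟩ := Submodule.mem_span_singleton.1 hrt
    have hcop : IsCoprime (f i) (f j) := by
      refine ((hirr i).coprime_iff_not_dvd).2 fun hd => hij (hdist ?_)
      exact eq_of_monic_of_associated (hmon i) (hmon j) ((hirr i).associated_of_dvd (hirr j) hd)
    obtain ⟨u, v, huv⟩ := hcop
    apply hr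
    rw [← one_smul (ZMod p)[X] (a • t), ← huv, add_smul, mul_smul, h, mul_smul, smul_comm (f j),
      ht, smul_zero, smul_zero, smul_zero, add_zero]
  rw [hset, Set.ncard_image_of_injective _ (Submodule.restrictScalars_injective _ _ _),
    Set.ncard_iUnion_of_finite (fun _ => Set.toFinite _) hdisj, finsum_eq_sum_of_fintype]
  refine Finset.sum_congr rfl fun i _ => ?_
  obtain ⟨g, hg⟩ : f i ∣ X ^ n - 1 := hprod ▸ Finset.dvd_prod_of_mem f (Finset.mem_univ i)
  refine ncard_span_singleton_torsion (hirr i)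
    (Nat.one_lt_pow (hirr i).natDegree_pos.ne' (Fact.out : p.Prime).one_lt) ?_
    (ncard_torsion (hmon i) (right_ne_zero_of_mul (hg ▸ hX)) hg.symm)
  exact (AdjoinRoot.natCard_eq_pow_natDegree (hmon i)).trans (by rw [Nat.card_zmod])

end AdditiveCyclic

/-- with `x^n − 1 = ∏_{i=1}^s f_i` (distinct monic irreducibles over `F_p`) and
`N_i = ⟨(x^n−1)/f_i⟩ ⊆ R = F_{p^2}[x]/⟨x^n−1⟩`, an additive cyclic code `C` is irreducible
iff `C = ⟨r⟩_{F_p[x]}` for some nonzero `r ∈ N_i`, `1 ≤ i ≤ s`; and the number of distinct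
irreducible additive cyclic codes is `∑_{i=1}^s (p^{deg f_i} + 1)`. -/
theorem irreducible_codes_characterization_and_count
    (p n : ℕ) [Fact p.Prime] (hn : 0 < n) (hco : Nat.Coprime n p)
    (s : ℕ) (f : Fin s → Polynomial (ZMod p))
    (hmon : ∀ i, (f i).Monic) (hirr : ∀ i, Irreducible (f i))
    (hdist : Function.Injective f)
    (hprod : ∏ i, f i = X ^ n - 1) :
    (∀ C : Submodule (ZMod p) (Rq p n), IsAdditiveCyclic p n C →
      (IsIrreducibleACC p n C ↔
        ∃ (i : Fin s) (r : Rq p n), r ≠ 0 ∧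
          r ∈ Ideal.span {phi p n ((X ^ n - 1) / f i)} ∧
          (C : Set (Rq p n)) = genSet p n r)) ∧
    Set.ncard {C : Submodule (ZMod p) (Rq p n) | IsIrreducibleACC p n C} =
      ∑ i, (p ^ (f i).natDegree + 1) := by
  exact ⟨fun C _ => AdditiveCyclic.isIrreducibleACC_iff_exists_genSet hirr hprod C,
    AdditiveCyclic.ncard_isIrreducibleACC hn hmon hirr hdist hprod⟩
end

section
/- Let C = ⟨g(x)+ω·k(x), ω·h(x)⟩_{F_p[x]} be an additive cyclic code of length n over F_{p^2}. Let G(x) = (x^n−1)/gcd(x^n−1, g(x)), and let S(x) be the generator polynomial of the intersection of the length-n linear cyclic codes over F_p generated by k(x) and by h(x). Let D_1, D_2, D_3, D_4 be the length-n linear cyclic codes over F_p generated by g(x), gcd(k(x), h(x)), gcd(G(x)·k(x), h(x)), and g(x)·S(x)/gcd(x^n−1, k(x)), respectively. Then min{ d(D_3), d(D_4), max{d(D_1), d(D_2)} } ≤ d(C), where any zero code D_i is discarded from the minimum (equivalently d({0}) = ∞). -/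
open Polynomial

theorem monicXn {F : Type*} [Field F] (n : ℕ) (hn : n ≠ 0) :
    ((X : Polynomial F) ^ n - 1).Monic := by
  simpa using Polynomial.monic_X_pow_sub_C (1 : F) hn

/-- The Hamming weight of an element of `F[x]/⟨x^n - 1⟩`: the number of nonzero
coefficients of its canonical representative of degree `< n`. -/
noncomputable def wt {F : Type*} [Field F] (n : ℕ) (hn : n ≠ 0)
    (y : AdjoinRoot ((X : Polynomial F) ^ n - 1)) : ℕ :=
  ((AdjoinRoot.modByMonicHom (monicXn n hn) y).support).card

/-- The minimum distance `d(C)` of a code `C ⊆ F[x]/⟨x^n - 1⟩` (with `d({0}) = ∞`). -/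
noncomputable def dmin {F : Type*} [Field F] (n : ℕ) (hn : n ≠ 0)
    (C : Set (AdjoinRoot ((X : Polynomial F) ^ n - 1))) : ℕ∞ :=
  sInf ((fun y => (wt n hn y : ℕ∞)) '' (C \ {0}))

theorem dmin_le_wt {F : Type*} [Field F] {n : ℕ} (hn : n ≠ 0)
    {C : Set (AdjoinRoot ((X : Polynomial F) ^ n - 1))}
    {y : AdjoinRoot ((X : Polynomial F) ^ n - 1)} (hy : y ∈ C) (hy0 : y ≠ 0) :
    dmin n hn C ≤ wt n hn y :=
  sInf_le ⟨y, ⟨hy, hy0⟩, rfl⟩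

theorem AdjoinRoot.mk_mem_span_of_dvd {R : Type*} [CommRing R] {M s t : Polynomial R}
    (hst : s ∣ t) : AdjoinRoot.mk M t ∈ Ideal.span {AdjoinRoot.mk M s} :=
  Ideal.mem_span_singleton.2 (map_dvd _ hst)

theorem AdjoinRoot.dvd_of_mk_mem_span {R : Type*} [CommRing R] {M s t d : Polynomial R}
    (hdM : d ∣ M) (hds : d ∣ s) (ht : AdjoinRoot.mk M t ∈ Ideal.span {AdjoinRoot.mk M s}) :
    d ∣ t := by
  obtain ⟨c, hc⟩ := Ideal.mem_span_singleton.1 ht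
  obtain ⟨c, rfl⟩ := AdjoinRoot.mk_surjective c
  rw [← map_mul, AdjoinRoot.mk_eq_mk] at hc
  exact (dvd_sub_left (hds.mul_right c)).1 (hdM.trans hc)

/-- If `ω` lies outside the base field, the coefficients of `A + ωB` vanish exactly where those of
both `A` and `B` do. -/
theorem support_map_add_C_mul_map {K L : Type*} [Field K] [Field L] [Algebra K L] {ω : L}
    (hω : ω ∉ Set.range (algebraMap K L)) (A B : Polynomial K) :
    (A.map (algebraMap K L) + C ω * B.map (algebraMap K L)).support = A.support ∪ B.support := by
  ext i
  simp only [mem_support_iff, Finset.mem_union, coeff_add, coeff_map, coeff_C_mul]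
  rw [← not_and_or, not_iff_not]
  refine ⟨fun h0 => ?_, fun ⟨hA, hB⟩ => by simp [hA, hB]⟩
  have hB : B.coeff i = 0 := by
    by_contra hB
    refine hω ⟨-A.coeff i / B.coeff i, ?_⟩
    have hB' : algebraMap K L (B.coeff i) ≠ 0 := by simpa using hB
    rw [map_div₀, map_neg, div_eq_iff hB']
    linear_combination -h0
  simpa [hB] using h0

theorem wt_mk_map_add_C_mul_map {K L : Type*} [Field K] [Field L] [Algebra K L] {ω : L}
    (hω : ω ∉ Set.range (algebraMap K L)) (n : ℕ) (hn : n ≠ 0) (A B : Polynomial K) :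
    wt n hn (AdjoinRoot.mk ((X : Polynomial L) ^ n - 1)
        (A.map (algebraMap K L) + C ω * B.map (algebraMap K L))) =
      ((A %ₘ (X ^ n - 1)).support ∪ (B %ₘ (X ^ n - 1)).support).card := by
  have hM : (X : Polynomial L) ^ n - 1 = ((X : Polynomial K) ^ n - 1).map (algebraMap K L) := by
    simp
  rw [← support_map_add_C_mul_map hω, wt, AdjoinRoot.modByMonicHom_mk, add_modByMonic,
    ← smul_eq_C_mul, smul_modByMonic, hM, ← map_modByMonic _ (monicXn n hn),
    ← map_modByMonic _ (monicXn n hn), smul_eq_C_mul]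

theorem wt_mk {F : Type*} [Field F] (n : ℕ) (hn : n ≠ 0) (A : Polynomial F) :
    wt n hn (AdjoinRoot.mk ((X : Polynomial F) ^ n - 1) A) =
      (A %ₘ (X ^ n - 1)).support.card := by
  rw [wt, AdjoinRoot.modByMonicHom_mk]

theorem wt_left_le_wt_mk_map_add {K L : Type*} [Field K] [Field L] [Algebra K L] {ω : L}
    (hω : ω ∉ Set.range (algebraMap K L)) (n : ℕ) (hn : n ≠ 0) (A B : Polynomial K) :
    wt n hn (AdjoinRoot.mk ((X : Polynomial K) ^ n - 1) A) ≤
      wt n hn (AdjoinRoot.mk ((X : Polynomial L) ^ n - 1)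
        (A.map (algebraMap K L) + C ω * B.map (algebraMap K L))) := by
  rw [wt_mk, wt_mk_map_add_C_mul_map hω]
  exact Finset.card_le_card Finset.subset_union_left

theorem wt_right_le_wt_mk_map_add {K L : Type*} [Field K] [Field L] [Algebra K L] {ω : L}
    (hω : ω ∉ Set.range (algebraMap K L)) (n : ℕ) (hn : n ≠ 0) (A B : Polynomial K) :
    wt n hn (AdjoinRoot.mk ((X : Polynomial K) ^ n - 1) B) ≤
      wt n hn (AdjoinRoot.mk ((X : Polynomial L) ^ n - 1)
        (A.map (algebraMap K L) + C ω * B.map (algebraMap K L))) := by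
  rw [wt_mk, wt_mk_map_add_C_mul_map hω]
  exact Finset.card_le_card Finset.subset_union_right

theorem AdjoinRoot.mk_map_eq_zero {R S : Type*} [CommRing R] [CommRing S] (f : R →+* S)
    {M A : Polynomial R} {N : Polynomial S} (hN : M.map f = N) (hA : AdjoinRoot.mk M A = 0) :
    AdjoinRoot.mk N (A.map f) = 0 :=
  AdjoinRoot.mk_eq_zero.2 (hN ▸ Polynomial.map_dvd f (AdjoinRoot.mk_eq_zero.1 hA))

theorem notMem_range_algebraMap_of_irreducible {K L : Type*} [Field K] [Field L] [Algebra K L]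
    {ω : L} {q : Polynomial K} (hq : Irreducible q) (hdeg : q.natDegree ≠ 1)
    (hroot : aeval ω q = 0) : ω ∉ Set.range (algebraMap K L) := by
  rintro ⟨r, rfl⟩
  rw [aeval_algebraMap_apply, map_eq_zero] at hroot
  exact hdeg (natDegree_eq_of_degree_eq_some (degree_eq_one_of_irreducible_of_root hq hroot))

theorem EuclideanDomain.div_gcd_dvd_of_dvd_mul {R : Type*} [EuclideanDomain R] [DecidableEq R]
    {M g a : R} (hM : M ≠ 0) (hag : M ∣ a * g) : M / EuclideanDomain.gcd M g ∣ a := by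
  have hd : EuclideanDomain.gcd M g ≠ 0 := fun h => hM (EuclideanDomain.gcd_eq_zero_iff.1 h).1
  obtain ⟨m, hm⟩ := EuclideanDomain.gcd_dvd_left M g
  have hb := EuclideanDomain.gcd_eq_gcd_ab M g
  set d := EuclideanDomain.gcd M g
  have hmd : M / d = m := by
    conv_lhs => rw [hm]
    exact mul_div_cancel_left₀ m hd
  rw [hmd]
  refine (mul_dvd_mul_iff_left hd).1 ?_
  rw [← hm, hb, add_mul]
  refine dvd_add ((dvd_mul_right M _).mul_right a) ?_
  rw [show g * EuclideanDomain.gcdB M g * a = a * g * EuclideanDomain.gcdB M g by ring]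
  exact hag.mul_right _

theorem EuclideanDomain.dvd_gcd_mul_of_dvd_mul {R : Type*} [EuclideanDomain R] [DecidableEq R]
    {M k S a : R} (hSM : S ∣ M) (hSk : S ∣ a * k) : S ∣ EuclideanDomain.gcd M k * a := by
  rw [EuclideanDomain.gcd_eq_gcd_ab M k, add_mul]
  refine dvd_add ((hSM.mul_right _).mul_right _) ?_
  rw [show k * EuclideanDomain.gcdB M k * a = a * k * EuclideanDomain.gcdB M k by ring]
  exact hSk.mul_right _

/-- minimum-distance lower bound for the additive cyclic code
`C = ⟨g(x)+ω·k(x), ω·h(x)⟩_{F_p[x]}` in terms of the linear cyclic codes over `F_p`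
generated by `g`, `gcd(k,h)`, `gcd(G·k, h)` (where `G = (x^n−1)/gcd(x^n−1,g)`) and
`g·S/gcd(x^n−1,k)` (where `S` is the generator polynomial of the intersection of the
cyclic codes generated by `k` and by `h`). -/
theorem distance_bound_two_generators
    (p n : ℕ) [Fact p.Prime] (hn : n ≠ 0) (hco : Nat.Coprime n p)
    (ω : GaloisField p 2)
    (hω : ∃ q : Polynomial (ZMod p), Irreducible q ∧ q.natDegree = 2 ∧
      Polynomial.aeval ω q = 0)
    (g k h S : Polynomial (ZMod p))
    (hSmon : S.Monic) (hSdvd : S ∣ X ^ n - 1)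
    (hSgen : Ideal.span {AdjoinRoot.mk ((X : Polynomial (ZMod p)) ^ n - 1) S} =
      Ideal.span {AdjoinRoot.mk ((X : Polynomial (ZMod p)) ^ n - 1) k} ⊓
        Ideal.span {AdjoinRoot.mk ((X : Polynomial (ZMod p)) ^ n - 1) h}) :
    min
      (min
        (dmin (F := ZMod p) n hn (Ideal.span {AdjoinRoot.mk ((X : Polynomial (ZMod p)) ^ n - 1)
          (EuclideanDomain.gcd (((X ^ n - 1) / EuclideanDomain.gcd (X ^ n - 1) g) * k) h)} :
            Ideal (AdjoinRoot ((X : Polynomial (ZMod p)) ^ n - 1))))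
        (dmin (F := ZMod p) n hn (Ideal.span {AdjoinRoot.mk ((X : Polynomial (ZMod p)) ^ n - 1)
          (g * S / EuclideanDomain.gcd (X ^ n - 1) k)} : Ideal (AdjoinRoot ((X : Polynomial (ZMod p)) ^ n - 1)))))
      (max
        (dmin (F := ZMod p) n hn (Ideal.span {AdjoinRoot.mk ((X : Polynomial (ZMod p)) ^ n - 1) g} : Ideal (AdjoinRoot ((X : Polynomial (ZMod p)) ^ n - 1))))
        (dmin (F := ZMod p) n hn (Ideal.span {AdjoinRoot.mk ((X : Polynomial (ZMod p)) ^ n - 1)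
          (EuclideanDomain.gcd k h)} : Ideal (AdjoinRoot ((X : Polynomial (ZMod p)) ^ n - 1))))) ≤
    dmin (F := GaloisField p 2) n hn {w : Rq p n | ∃ a b : Polynomial (ZMod p),
      w = phi p n a * (phi p n g + algebraMap (GaloisField p 2) (Rq p n) ω * phi p n k) +
          phi p n b * (algebraMap (GaloisField p 2) (Rq p n) ω * phi p n h)} := by
  classical
  obtain ⟨q, hq, hq2, hroot⟩ := hω
  have hω' := notMem_range_algebraMap_of_irreducible hq (by omega) hroot
  have hM0 : (X : Polynomial (ZMod p)) ^ n - 1 ≠ 0 := (monicXn n hn).ne_zero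
  refine le_sInf ?_
  rintro _ ⟨w, ⟨⟨a, b, rfl⟩, hw⟩, rfl⟩
  set A := a * g with hA
  set B := a * k + b * h with hB
  have hwAB : phi p n a * (phi p n g + algebraMap (GaloisField p 2) (Rq p n) ω * phi p n k) +
      phi p n b * (algebraMap (GaloisField p 2) (Rq p n) ω * phi p n h) =
      AdjoinRoot.mk ((X : Polynomial (GaloisField p 2)) ^ n - 1)
        (A.map (algebraMap (ZMod p) (GaloisField p 2)) +
          C ω * B.map (algebraMap (ZMod p) (GaloisField p 2))) := by
    simp only [phi, RingHom.comp_apply, coe_mapRingHom, AdjoinRoot.algebraMap_eq, hA, hB,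
      ← AdjoinRoot.mk_C, Polynomial.map_mul, Polynomial.map_add, map_mul, map_add]
    ring
  simp only [hwAB] at hw ⊢
  have hwA := wt_left_le_wt_mk_map_add hω' n hn A B
  have hwB := wt_right_le_wt_mk_map_add hω' n hn A B
  by_cases hA0 : AdjoinRoot.mk ((X : Polynomial (ZMod p)) ^ n - 1) A = 0
  · have hB0 : AdjoinRoot.mk ((X : Polynomial (ZMod p)) ^ n - 1) B ≠ 0 := by
      intro hB0
      have hN : ((X : Polynomial (ZMod p)) ^ n - 1).map
          (algebraMap (ZMod p) (GaloisField p 2)) = X ^ n - 1 := by simp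
      refine hw ?_
      rw [Set.mem_singleton_iff, map_add, map_mul, AdjoinRoot.mk_map_eq_zero _ hN hA0,
        AdjoinRoot.mk_map_eq_zero _ hN hB0, mul_zero, add_zero]
    have hGa := EuclideanDomain.div_gcd_dvd_of_dvd_mul hM0 (AdjoinRoot.mk_eq_zero.1 hA0)
    refine (min_le_left _ _).trans ((min_le_left _ _).trans
      ((dmin_le_wt hn (AdjoinRoot.mk_mem_span_of_dvd ?_) hB0).trans (by exact_mod_cast hwB)))
    exact dvd_add ((EuclideanDomain.gcd_dvd_left _ _).trans (mul_dvd_mul_right hGa k))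
      ((EuclideanDomain.gcd_dvd_right _ _).mul_left b)
  by_cases hB0 : AdjoinRoot.mk ((X : Polynomial (ZMod p)) ^ n - 1) B = 0
  · refine (min_le_left _ _).trans ((min_le_right _ _).trans
      ((dmin_le_wt hn (AdjoinRoot.mk_mem_span_of_dvd ?_) hA0).trans (by exact_mod_cast hwA)))
    have hSmem : AdjoinRoot.mk ((X : Polynomial (ZMod p)) ^ n - 1) S ∈
        Ideal.span {AdjoinRoot.mk ((X : Polynomial (ZMod p)) ^ n - 1) k} :=
      (hSgen.le (Ideal.mem_span_singleton_self _)).1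
    have hdS := AdjoinRoot.dvd_of_mk_mem_span (EuclideanDomain.gcd_dvd_left (X ^ n - 1) k)
      (EuclideanDomain.gcd_dvd_right (X ^ n - 1) k) hSmem
    have hSak : S ∣ a * k := by
      refine AdjoinRoot.dvd_of_mk_mem_span hSdvd dvd_rfl (hSgen.ge ⟨?_, ?_⟩)
      · exact AdjoinRoot.mk_mem_span_of_dvd (dvd_mul_left k a)
      · have hak : AdjoinRoot.mk ((X : Polynomial (ZMod p)) ^ n - 1) (a * k) =
            AdjoinRoot.mk _ (-b * h) := by
          rw [AdjoinRoot.mk_eq_mk]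
          simpa [hB] using AdjoinRoot.mk_eq_zero.1 hB0
        rw [hak]
        exact AdjoinRoot.mk_mem_span_of_dvd (dvd_mul_left h (-b))
    have hSda := EuclideanDomain.dvd_gcd_mul_of_dvd_mul hSdvd hSak
    have hd : EuclideanDomain.gcd (X ^ n - 1) k ≠ 0 := fun h0 =>
      hM0 (EuclideanDomain.gcd_eq_zero_iff.1 h0).1
    rw [EuclideanDomain.mul_div_assoc _ hdS, hA, mul_comm a g]
    refine mul_dvd_mul_left g ((mul_dvd_mul_iff_left hd).1 ?_)
    rwa [EuclideanDomain.mul_div_cancel' hd hdS]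
  · refine (min_le_right _ _).trans (max_le ?_ ?_)
    · exact (dmin_le_wt hn (AdjoinRoot.mk_mem_span_of_dvd (dvd_mul_left g a)) hA0).trans
        (by exact_mod_cast hwA)
    · refine (dmin_le_wt hn (AdjoinRoot.mk_mem_span_of_dvd ?_) hB0).trans (by exact_mod_cast hwB)
      exact dvd_add ((EuclideanDomain.gcd_dvd_left _ _).mul_left a)
        ((EuclideanDomain.gcd_dvd_right _ _).mul_left b)
end

section
/- Let p be a prime and n a positive integer with gcd(n,p)=1, let d = gcd(n, p−1) and d' = gcd(n, p^2−1). Then the number of p-cyclotomic cosets modulo n of size exactly two is (d' − d)/2. -/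
/-- The `p`-cyclotomic coset modulo `n` containing `a`: the orbit `{a, pa, p²a, …}` of `a`
under multiplication by `p` in `ℤ/nℤ`. -/
def cyclotomicCoset (p n : ℕ) (a : ZMod n) : Set (ZMod n) :=
  {b : ZMod n | ∃ m : ℕ, b = (p : ZMod n) ^ m * a}

open Classical in
theorem ZMod.card_filter_natCast_mul_eq_zero (n k : ℕ) [NeZero n] :
    (Finset.univ.filter fun a : ZMod n => (k : ZMod n) * a = 0).card = n.gcd k := by
  have h := IsAddCyclic.card_nsmulAddMonoidHom_ker (G := ZMod n) k
  rw [Nat.card_zmod] at h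
  rw [← h, ← Fintype.card_subtype, ← Nat.card_eq_fintype_card]
  exact Nat.card_congr (Equiv.subtypeEquivRight fun a => by simp [AddMonoidHom.mem_ker])

open Classical in
theorem ZMod.card_filter_natCast_mul_eq_self (n q : ℕ) [NeZero n] (hq : 1 ≤ q) :
    (Finset.univ.filter fun a : ZMod n => (q : ZMod n) * a = a).card = n.gcd (q - 1) := by
  rw [← ZMod.card_filter_natCast_mul_eq_zero]
  congr 1
  ext a
  simp [Nat.cast_sub hq, sub_mul, sub_eq_zero]

theorem mem_cyclotomicCoset_self (p n : ℕ) (a : ZMod n) : a ∈ cyclotomicCoset p n a :=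
  ⟨0, by simp⟩

theorem mul_mem_cyclotomicCoset (p n : ℕ) (a : ZMod n) :
    (p : ZMod n) * a ∈ cyclotomicCoset p n a :=
  ⟨1, by simp⟩

theorem cyclotomicCoset_eq_pair {p n : ℕ} {a : ZMod n} (h : (p : ZMod n) ^ 2 * a = a) :
    cyclotomicCoset p n a = {a, (p : ZMod n) * a} := by
  ext b
  simp only [Set.mem_insert_iff, Set.mem_singleton_iff]
  constructor
  · rintro ⟨m, rfl⟩
    induction m with
    | zero => simp
    | succ m ih =>
      rw [pow_succ', mul_assoc]
      rcases ih with ih | ih <;> rw [ih]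
      · exact Or.inr rfl
      · exact Or.inl (by rw [← mul_assoc, ← pow_two, h])
  · rintro (rfl | rfl)
    · exact mem_cyclotomicCoset_self p n b
    · exact mul_mem_cyclotomicCoset p n a

theorem ncard_cyclotomicCoset_eq_two_iff {p n : ℕ} [NeZero n] (hp : IsUnit (p : ZMod n))
    (a : ZMod n) :
    (cyclotomicCoset p n a).ncard = 2 ↔ (p : ZMod n) ^ 2 * a = a ∧ (p : ZMod n) * a ≠ a := by
  constructor
  · intro h
    have hne : (p : ZMod n) * a ≠ a := by
      intro ha
      rw [cyclotomicCoset_eq_pair (by rw [pow_two, mul_assoc, ha, ha]), ha] at h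
      simp at h
    have hpair : {a, (p : ZMod n) * a} = cyclotomicCoset p n a := by
      refine Set.eq_of_subset_of_ncard_le ?_ ?_ (Set.toFinite _)
      · rintro b (rfl | rfl)
        · exact mem_cyclotomicCoset_self p n b
        · exact mul_mem_cyclotomicCoset p n a
      · rw [h, Set.ncard_pair hne.symm]
    have hmem : (p : ZMod n) ^ 2 * a ∈ cyclotomicCoset p n a := ⟨2, rfl⟩
    rw [← hpair] at hmem
    refine ⟨hmem.resolve_right fun h2 => hne ?_, hne⟩
    rw [Set.mem_singleton_iff, pow_two, mul_assoc] at h2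
    exact hp.mul_left_cancel h2
  · rintro ⟨h, hne⟩
    rw [cyclotomicCoset_eq_pair h, Set.ncard_pair hne.symm]

theorem cyclotomicCoset_eq_iff_mem {p n : ℕ} {a b : ZMod n} (h : (p : ZMod n) ^ 2 * a = a) :
    cyclotomicCoset p n b = cyclotomicCoset p n a ↔ b ∈ cyclotomicCoset p n a := by
  refine ⟨fun hb => hb ▸ mem_cyclotomicCoset_self p n b, fun hb => ?_⟩
  rw [cyclotomicCoset_eq_pair h] at hb
  rcases hb with rfl | rfl
  · rfl
  · have h' : (p : ZMod n) * (p * a) = a := by rw [← mul_assoc, ← pow_two, h]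
    rw [cyclotomicCoset_eq_pair h, cyclotomicCoset_eq_pair (by rw [pow_two, mul_assoc, h']), h',
      Set.pair_comm]

/-- let `p` be prime, `gcd(n,p)=1`, `d = gcd(n, p−1)` and
`d' = gcd(n, p²−1)`.  Then the number of `p`-cyclotomic cosets modulo `n` of size exactly
two is `(d' − d)/2`. -/
theorem size_two_cyclotomic_cosets
    (p n : ℕ) (hp : p.Prime) (hn : 0 < n) (hco : Nat.Coprime n p)
    (d d' : ℕ) (hd : d = Nat.gcd n (p - 1)) (hd' : d' = Nat.gcd n (p ^ 2 - 1)) :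
    Set.ncard {Z : Set (ZMod n) | (∃ a : ZMod n, Z = cyclotomicCoset p n a) ∧
        Z.ncard = 2} = (d' - d) / 2 := by
  classical
  have : NeZero n := ⟨hn.ne'⟩
  have hu : IsUnit (p : ZMod n) := (ZMod.isUnit_iff_coprime p n).2 hco.symm
  set F : Finset (ZMod n) := Finset.univ.filter fun a => (p : ZMod n) * a = a with hF
  set G : Finset (ZMod n) := Finset.univ.filter fun a => (p : ZMod n) ^ 2 * a = a with hG
  have hFcard : F.card = d := by
    rw [hd, ← ZMod.card_filter_natCast_mul_eq_self n p hp.one_le]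
  have hGcard : G.card = d' := by
    rw [hd', ← ZMod.card_filter_natCast_mul_eq_self n (p ^ 2) (Nat.one_le_pow _ _ hp.pos)]
    simp [hG]
  have hFG : F ⊆ G := by
    intro a ha
    simp only [hF, hG, Finset.mem_filter_univ] at ha ⊢
    rw [pow_two, mul_assoc, ha, ha]
  have hmem : ∀ a, a ∈ G \ F ↔ (p : ZMod n) ^ 2 * a = a ∧ (p : ZMod n) * a ≠ a := by
    simp [hF, hG]
  have hcosets : {Z : Set (ZMod n) | (∃ a : ZMod n, Z = cyclotomicCoset p n a) ∧ Z.ncard = 2} =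
      ((G \ F).image (cyclotomicCoset p n) : Finset (Set (ZMod n))) := by
    ext Z
    simp only [Set.mem_ofPred_eq, Finset.coe_image, Set.mem_image, Finset.mem_coe, hmem]
    constructor
    · rintro ⟨⟨a, rfl⟩, h⟩
      exact ⟨a, (ncard_cyclotomicCoset_eq_two_iff hu a).1 h, rfl⟩
    · rintro ⟨a, h, rfl⟩
      exact ⟨⟨a, rfl⟩, (ncard_cyclotomicCoset_eq_two_iff hu a).2 h⟩
  have hfiber : ∀ Z ∈ (G \ F).image (cyclotomicCoset p n),
      ((G \ F).filter fun b => cyclotomicCoset p n b = Z).card = 2 := by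
    intro Z hZ
    obtain ⟨a, ha, rfl⟩ := Finset.mem_image.1 hZ
    rw [hmem] at ha
    have h2 := (ncard_cyclotomicCoset_eq_two_iff hu a).2 ha
    rw [← h2, ← Set.ncard_coe_finset]
    congr 1
    ext b
    simp only [Finset.coe_filter, Set.mem_ofPred_eq, hmem, cyclotomicCoset_eq_iff_mem ha.1,
      and_iff_right_iff_imp]
    intro hb
    rw [← ncard_cyclotomicCoset_eq_two_iff hu, (cyclotomicCoset_eq_iff_mem ha.1).2 hb, h2]
  have hcount := Finset.card_eq_sum_card_image (cyclotomicCoset p n) (G \ F)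
  rw [Finset.sum_congr rfl hfiber, Finset.sum_const, smul_eq_mul,
    Finset.card_sdiff_of_subset hFG, hFcard, hGcard] at hcount
  rw [hcosets, Set.ncard_coe_finset, hcount, Nat.mul_div_cancel _ two_pos]
end
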